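/- Let 0 < σ < 1 and 1 ≤ p < ∞. For measurable w : ℝ^m → ℝ, one has [w]_{W^{σ,p}(ℝ^m)} ≤ C Σ_{j=1}^m (∫_{ℝ^m} ∫_0^∞ |w(x + t e_j) - w(x)|^p / t^{1+σp} dt dx)^{1/p}, where (e_1,…,e_m) is the canonical basis of ℝ^m and C > 0 depends only on m, σ, p. -/

import Mathlib

open MeasureTheory
noncomputable def DD {m : ℕ} (p : ℝ) (w : EuclideanSpace ℝ (Fin m) → ℝ) (h : EuclideanSpace ℝ (Fin m)) : ENNReal :=
  ∫⁻ x, ENNReal.ofReal (|w (x + h) - w x| ^ p)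

section helpers
variable {m : ℕ} {p : ℝ} {w : EuclideanSpace ℝ (Fin m) → ℝ}

lemma DD_meas (hw : Measurable w) : Measurable (DD p w) := by
  unfold DD
  apply Measurable.lintegral_prod_right' (f := fun z : EuclideanSpace ℝ (Fin m) × EuclideanSpace ℝ (Fin m) => ENNReal.ofReal (|w (z.2 + z.1) - w z.2| ^ p))
  fun_prop

lemma DD_neg (h : EuclideanSpace ℝ (Fin m)) : DD p w (-h) = DD p w h := by
  unfold DD
  rw [← lintegral_add_right_eq_self _ h]
  simp [abs_sub_comm]

lemma DD_eq (hp : 1 ≤ p) (h : EuclideanSpace ℝ (Fin m)) :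
    DD p w h = (eLpNorm (fun x => w (x + h) - w x) (ENNReal.ofReal p) volume) ^ p := by
  have hp0 : 0 < p := by linarith
  rw [eLpNorm_eq_lintegral_rpow_enorm_toReal (by simpa using hp0) (by simp), ENNReal.toReal_ofReal hp0.le,
    ← ENNReal.rpow_mul]
  rw [one_div_mul_cancel hp0.ne', ENNReal.rpow_one]
  unfold DD
  congr 1; ext x
  rw [Real.enorm_eq_ofReal_abs, ENNReal.ofReal_rpow_of_nonneg (abs_nonneg _) hp0.le]

lemma NN_add (hw : Measurable w) (hp : 1 ≤ p) (a b : EuclideanSpace ℝ (Fin m)) :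
    eLpNorm (fun x => w (x + (a+b)) - w x) (ENNReal.ofReal p) volume ≤
    eLpNorm (fun x => w (x + a) - w x) (ENNReal.ofReal p) volume + eLpNorm (fun x => w (x + b) - w x) (ENNReal.ofReal p) volume := by
  have h1 : eLpNorm (fun x => w (x + a) - w x) (ENNReal.ofReal p) volume
     = eLpNorm ((fun x => w (x + a) - w x) ∘ (fun x => x + b)) (ENNReal.ofReal p) volume := by
    rw [eLpNorm_comp_measurePreserving (ν := volume)]
    · fun_prop
    · exact measurePreserving_add_right volume b
  rw [h1]
  refine le_trans (le_of_eq ?_) (eLpNorm_add_le (by fun_prop) (by fun_prop) (by simpa using hp))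
  congr 1; ext x
  simp only [Pi.add_apply, Function.comp]
  rw [show x + (a+b) = x + b + a by abel]; ring

lemma DD_le (hw : Measurable w) (hp : 1 ≤ p) (h : EuclideanSpace ℝ (Fin m)) :
    DD p w h ≤ (m:ENNReal) ^ (p-1) * ∑ j, DD p w (h j • EuclideanSpace.single j 1) := by
  have hh : h = ∑ j, h j • EuclideanSpace.single j (1:ℝ) := by
    ext i; simp [Pi.single_apply]
  simp_rw [DD_eq hp]
  have key := Finset.le_sum_of_subadditive (fun h => eLpNorm (fun x => w (x + h) - w x) (ENNReal.ofReal p) volume)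
    (by simp) (NN_add hw hp) Finset.univ (fun j => h j • EuclideanSpace.single j (1:ℝ))
  rw [← hh] at key
  refine (ENNReal.rpow_le_rpow key (by linarith)).trans ?_
  have := ENNReal.rpow_sum_le_const_mul_sum_rpow (Finset.univ) (fun j => eLpNorm (fun x => w (x + h j • EuclideanSpace.single j (1:ℝ)) - w x) (ENNReal.ofReal p) volume) hp
  simpa using this

lemma even_lint (g : ℝ → ENNReal) (hg : ∀ s, g (-s) = g s) :
    ∫⁻ s, g s = 2 * ∫⁻ s in Set.Ioi 0, g s := by
  have h1 : ∫⁻ s in Set.Iio 0, g s = ∫⁻ s in Set.Ioi 0, g s := by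
    have := (Measure.measurePreserving_neg (volume : Measure ℝ)).setLIntegral_comp_preimage_emb
      (MeasurableEquiv.neg ℝ).measurableEmbedding g (Set.Ioi 0)
    rw [← this]
    simp [hg]
  rw [← lintegral_add_compl g (measurableSet_Ioi (a := (0:ℝ))), Set.compl_Ioi, setLIntegral_congr (Iio_ae_eq_Iic (a := (0:ℝ))).symm, h1, two_mul]

lemma scal (n : ℕ) (a s : ℝ) (hs : s ≠ 0) :
    ∫⁻ z : Fin n → ℝ, ENNReal.ofReal ((|s| + ‖z‖) ^ (-a)) =
     ENNReal.ofReal (|s| ^ ((n:ℝ) - a)) * ∫⁻ z : Fin n → ℝ, ENNReal.ofReal ((1 + ‖z‖) ^ (-a)) := by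
  have hs' : 0 < |s| := abs_pos.2 hs
  have h1 := Measure.map_addHaar_smul (volume : Measure (Fin n → ℝ)) hs
  have h2 : ∫⁻ z : Fin n → ℝ, ENNReal.ofReal ((|s| + ‖s • z‖) ^ (-a)) = 
     ENNReal.ofReal (|(s^n)⁻¹|) * ∫⁻ z : Fin n → ℝ, ENNReal.ofReal ((|s| + ‖z‖) ^ (-a)) := by
    have := lintegral_map (μ := (volume : Measure (Fin n → ℝ))) (f := fun z => ENNReal.ofReal ((|s| + ‖z‖) ^ (-a))) (g := fun z => s • z) (by fun_prop) (by fun_prop)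
    rw [← this, h1]
    simp
  have h3 : ∀ z : Fin n → ℝ, ENNReal.ofReal ((|s| + ‖s • z‖) ^ (-a)) = ENNReal.ofReal (|s| ^ (-a)) * ENNReal.ofReal ((1 + ‖z‖) ^ (-a)) := by
    intro z
    rw [← ENNReal.ofReal_mul (by positivity), ← Real.mul_rpow (by positivity) (by positivity), norm_smul, Real.norm_eq_abs]
    ring_nf
  simp_rw [h3] at h2
  rw [lintegral_const_mul _ (by fun_prop)] at h2
  rw [sub_eq_add_neg, Real.rpow_add hs', ENNReal.ofReal_mul (by positivity), mul_assoc, h2, ← mul_assoc, ← ENNReal.ofReal_mul (by positivity)]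
  rw [abs_inv, abs_pow, Real.rpow_natCast, mul_inv_cancel₀ (by positivity)]
  simp

lemma slice (n : ℕ) (b : ℝ) (hb : 0 < b) (j : Fin (n+1)) (g : ℝ → ENNReal) (hg : Measurable g) :
    ∫⁻ h : EuclideanSpace ℝ (Fin (n+1)), g (h j) * ENNReal.ofReal (‖h‖ ^ (-((n:ℝ)+1+b))) ≤
    (ENNReal.ofReal (2 ^ ((n:ℝ)+1+b)) * ∫⁻ z : Fin n → ℝ, ENNReal.ofReal ((1 + ‖z‖) ^ (-((n:ℝ)+1+b)))) *
      ∫⁻ s, g s * ENNReal.ofReal (|s| ^ (-(1 + b))) := by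
  set a := (n:ℝ)+1+b with ha
  have ha0 : 0 < a := by positivity
  rw [← (EuclideanSpace.volume_preserving_symm_measurableEquiv_toLp (Fin (n+1))).symm.lintegral_comp_emb (MeasurableEquiv.measurableEmbedding _)]
  rw [← (volume_preserving_piFinSuccAbove (fun _ : Fin (n+1) => ℝ) j).symm.lintegral_comp_emb (MeasurableEquiv.measurableEmbedding _)]
  change ∫⁻ q : ℝ × (Fin n → ℝ), g ((WithLp.toLp 2 (j.insertNth q.1 q.2 : Fin (n+1) → ℝ)) j) * ENNReal.ofReal (‖WithLp.toLp 2 (j.insertNth q.1 q.2 : Fin (n+1) → ℝ)‖ ^ (-a)) ∂(volume.prod volume) ≤ _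
  have hne : ∀ᵐ q : ℝ × (Fin n → ℝ) ∂(volume.prod volume), q.1 ≠ 0 := by
    exact Measure.quasiMeasurePreserving_fst.ae (p := fun s : ℝ => s ≠ 0) (Measure.ae_ne volume 0)
  have step : ∫⁻ q : ℝ × (Fin n → ℝ), g ((WithLp.toLp 2 (j.insertNth q.1 q.2 : Fin (n+1) → ℝ)) j) * ENNReal.ofReal (‖WithLp.toLp 2 (j.insertNth q.1 q.2 : Fin (n+1) → ℝ)‖ ^ (-a)) ∂(volume.prod volume) ≤ 
    ∫⁻ q : ℝ × (Fin n → ℝ), g q.1 * (ENNReal.ofReal (2 ^ a) * ENNReal.ofReal ((|q.1| + ‖q.2‖) ^ (-a))) ∂(volume.prod volume) := by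
    apply lintegral_mono_ae
    filter_upwards [hne] with q hq
    have hq' : 0 < |q.1| := abs_pos.2 hq
    simp only [Fin.insertNth_apply_same]
    gcongr
    rw [← ENNReal.ofReal_mul (by positivity)]
    apply ENNReal.ofReal_le_ofReal
    set H := WithLp.toLp 2 (j.insertNth q.1 q.2 : Fin (n+1) → ℝ) with hH
    have e1 : |q.1| ≤ ‖H‖ := by
      simpa [hH] using PiLp.norm_apply_le H j
    have e2 : ‖q.2‖ ≤ ‖H‖ := by
      rw [pi_norm_le_iff_of_nonneg (norm_nonneg _)]
      intro i
      simpa [hH] using PiLp.norm_apply_le H (j.succAbove i)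
    have e3 : (|q.1| + ‖q.2‖)/2 ≤ ‖H‖ := by linarith
    calc ‖H‖ ^ (-a) ≤ ((|q.1| + ‖q.2‖)/2) ^ (-a) :=
          Real.rpow_le_rpow_of_nonpos (by positivity) e3 (by linarith)
      _ = _ := by
        rw [Real.div_rpow (by positivity) (by positivity), Real.rpow_neg (by norm_num : (0:ℝ) ≤ 2), div_inv_eq_mul, mul_comm]
  refine step.trans ?_
  rw [lintegral_prod _ (by fun_prop)]
  rw [← lintegral_const_mul _ (by fun_prop)]
  apply lintegral_mono_ae
  filter_upwards [Measure.ae_ne volume (0:ℝ)] with s hs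
  rw [lintegral_const_mul _ (by fun_prop), lintegral_const_mul _ (by fun_prop), scal n a s hs]
  rw [show (n:ℝ) - a = -(1+b) by rw [ha]; ring]
  apply le_of_eq; ring

end helpers

theorem stmt_12 (m : ℕ) (hm : 0 < m) (σ p : ℝ) (hσ0 : 0 < σ) (hσ1 : σ < 1) (hp : 1 ≤ p) :
    ∃ C : ℝ, 0 < C ∧ ∀ w : EuclideanSpace ℝ (Fin m) → ℝ, Measurable w →
      (∫⁻ x, ∫⁻ y, ENNReal.ofReal
          (|w x - w y| ^ p / ‖x - y‖ ^ ((m : ℝ) + σ * p))) ^ (1 / p)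
        ≤ ENNReal.ofReal C * ∑ j : Fin m,
            (∫⁻ x, ∫⁻ t in Set.Ioi (0 : ℝ), ENNReal.ofReal
              (|w (x + t • EuclideanSpace.single j 1) - w x| ^ p / t ^ (1 + σ * p))) ^ (1 / p) := by
  obtain ⟨n, rfl⟩ : ∃ n, m = n + 1 := ⟨m - 1, by omega⟩
  have hp0 : 0 < p := by linarith
  have hb : 0 < σ * p := by positivity
  set b := σ * p with hbdef
  set J := ENNReal.ofReal (2 ^ ((n:ℝ)+1+b)) * ∫⁻ z : Fin n → ℝ, ENNReal.ofReal ((1 + ‖z‖) ^ (-((n:ℝ)+1+b))) with hJ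
  have hJfin : J ≠ ⊤ := by
    apply ENNReal.mul_ne_top (by simp)
    apply ne_of_lt
    apply finite_integral_one_add_norm
    simp; linarith
  set A : ENNReal := (((n+1 : ℕ)):ENNReal) ^ (p-1) * (J * 2) with hA
  have hAfin : A ≠ ⊤ := by
    apply ENNReal.mul_ne_top
    · exact ENNReal.rpow_ne_top_of_nonneg (by linarith) (by simp)
    · exact ENNReal.mul_ne_top hJfin (by simp)
  have hA' : A ^ (1/p) ≠ ⊤ := ENNReal.rpow_ne_top_of_nonneg (by positivity) hAfin
  refine ⟨(A ^ (1/p)).toReal + 1, by positivity, fun w hw => ?_⟩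
  have hC : A ^ (1/p) ≤ ENNReal.ofReal ((A ^ (1/p)).toReal + 1) := by
    rw [← ENNReal.ofReal_toReal hA']
    apply ENNReal.ofReal_le_ofReal
    rw [ENNReal.toReal_ofReal (by positivity)]
    linarith
  have hR : ∀ j : Fin (n+1), ∫⁻ x, ∫⁻ t in Set.Ioi (0 : ℝ), ENNReal.ofReal
              (|w (x + t • EuclideanSpace.single j 1) - w x| ^ p / t ^ (1 + b)) =
      ∫⁻ t in Set.Ioi (0:ℝ), DD p w (t • EuclideanSpace.single j 1) * ENNReal.ofReal (|t| ^ (-(1+b))) := by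
    intro j
    rw [lintegral_lintegral_swap (by fun_prop)]
    apply setLIntegral_congr_fun measurableSet_Ioi
    intro t ht
    have ht : 0 < t := ht
    unfold DD
    beta_reduce
    rw [← lintegral_mul_const _ (by fun_prop)]
    congr 1; ext x
    rw [← ENNReal.ofReal_mul (by positivity), abs_of_pos ht, Real.rpow_neg ht.le, div_eq_mul_inv]
  have hL : ∫⁻ x, ∫⁻ y, ENNReal.ofReal (|w x - w y| ^ p / ‖x - y‖ ^ (((n+1:ℕ) : ℝ) + b)) =
      ∫⁻ h, DD p w h * ENNReal.ofReal (‖h‖ ^ (-((n:ℝ)+1+b))) := by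
    have : ∀ x, ∫⁻ y, ENNReal.ofReal (|w x - w y| ^ p / ‖x - y‖ ^ (((n+1:ℕ) : ℝ) + b)) = 
       ∫⁻ h, ENNReal.ofReal (|w (x+h) - w x| ^ p) * ENNReal.ofReal (‖h‖ ^ (-((n:ℝ)+1+b))) := by
      intro x
      rw [← lintegral_add_left_eq_self _ x]
      congr 1; ext h
      rw [← ENNReal.ofReal_mul (by positivity), Real.rpow_neg (norm_nonneg _), div_eq_mul_inv, abs_sub_comm]
      simp
    simp_rw [this]
    rw [lintegral_lintegral_swap (by fun_prop)]
    congr 1; ext h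
    unfold DD
    rw [← lintegral_mul_const _ (by fun_prop)]
  have hDm := DD_meas (p := p) hw
  have main : ∫⁻ h, DD p w h * ENNReal.ofReal (‖h‖ ^ (-((n:ℝ)+1+b))) ≤ A * ∑ j : Fin (n+1), 
      ∫⁻ t in Set.Ioi (0:ℝ), DD p w (t • EuclideanSpace.single j 1) * ENNReal.ofReal (|t| ^ (-(1+b))) := by
    calc _ ≤ ∫⁻ h : EuclideanSpace ℝ (Fin (n+1)), (((n+1 : ℕ)):ENNReal) ^ (p-1) * ∑ j, DD p w (h j • EuclideanSpace.single j 1) * ENNReal.ofReal (‖h‖ ^ (-((n:ℝ)+1+b))) := by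
          apply lintegral_mono
          intro h
          beta_reduce
          rw [← Finset.sum_mul, ← mul_assoc]
          gcongr
          exact DD_le hw hp h
      _ = (((n+1 : ℕ)):ENNReal) ^ (p-1) * ∑ j, ∫⁻ h : EuclideanSpace ℝ (Fin (n+1)), DD p w (h j • EuclideanSpace.single j 1) * ENNReal.ofReal (‖h‖ ^ (-((n:ℝ)+1+b))) := by
          rw [lintegral_const_mul _ (by fun_prop), lintegral_finsetSum _ (by fun_prop)]
      _ ≤ (((n+1 : ℕ)):ENNReal) ^ (p-1) * ∑ j : Fin (n+1), J * (2 * ∫⁻ t in Set.Ioi (0:ℝ), DD p w (t • EuclideanSpace.single j 1) * ENNReal.ofReal (|t| ^ (-(1+b)))) := by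
          gcongr with j
          rw [← even_lint]
          · exact slice n b hb j (fun s => DD p w (s • EuclideanSpace.single j 1)) (by fun_prop)
          · intro s
            rw [neg_smul, DD_neg, abs_neg]
      _ = _ := by
          rw [hA, Finset.mul_sum, Finset.mul_sum]
          apply Finset.sum_congr rfl
          intros; ring
  rw [hL]
  simp_rw [hR]
  refine (ENNReal.rpow_le_rpow main (by positivity)).trans ?_
  rw [ENNReal.mul_rpow_of_nonneg _ _ (by positivity)]
  gcongr
  apply Finset.le_sum_of_subadditive (fun x : ENNReal => x ^ (1/p))
  · simp [hp0]
  · intro x y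
    exact ENNReal.rpow_add_le_add_rpow _ _ (by positivity) (by rw [div_le_one hp0]; exact hp)
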